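/- Let n ≥ 1, let m : {1,…,n} → ℕ satisfy m_i ≥ 1 for all i, and let C ∈ ℕ^n satisfy ∑_{i=1}^n i·C_i = n. For x ∈ (0,1) define PM(x) = ∑_{z ∈ ℕ^n : ∑_i max(C_i − z_i, 0) > 1} ∏_{i=1}^n binom(z_i + m_i − 1, z_i)·x^{i·z_i}·(1 − x^i)^{m_i}. Then PM(x) → 0 as x → 1 from the left. -/

import Mathlib

open scoped BigOperators
open Filter

/-- The product of finitely many nonnegative series, expanded as a series over tuples. -/
theorem hasSum_prod_fin_of_nonneg {α : Type*} :
    ∀ {n : ℕ} {g : Fin n → α → ℝ} {a : Fin n → ℝ}, (∀ i k, 0 ≤ g i k) →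
      (∀ i, HasSum (g i) (a i)) →
      HasSum (fun z : Fin n → α => ∏ i, g i (z i)) (∏ i, a i) := by
  intro n
  induction n with
  | zero =>
    intro g a _ _
    simp
  | succ n ih =>
    intro g a hg h
    have htail := ih (fun i k => hg i.succ k) (fun i => h i.succ)
    have hsummable := (h 0).summable.mul_of_nonneg htail.summable (fun k => hg 0 k)
      (fun z => Finset.prod_nonneg fun i _ => hg i.succ (z i))
    have hmul := (h 0).mul htail hsummable
    rw [← (Fin.consEquiv fun _ => α).hasSum_iff, Fin.prod_univ_succ]
    refine hmul.congr_fun ?_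
    intro p
    simp [Fin.prod_univ_succ, Fin.consEquiv]

/-- The mass function of the negative binomial distribution with success probability `1 - q`. -/
noncomputable def negBinomialMass (m : ℕ) (q : ℝ) (k : ℕ) : ℝ :=
  ((k + m - 1).choose k : ℝ) * q ^ k * (1 - q) ^ m

theorem negBinomialMass_nonneg {m : ℕ} {q : ℝ} (h0 : 0 ≤ q) (h1 : q ≤ 1) (k : ℕ) :
    0 ≤ negBinomialMass m q k := by
  have := sub_nonneg.2 h1
  unfold negBinomialMass
  positivity

theorem hasSum_negBinomialMass {m : ℕ} (hm : 1 ≤ m) {q : ℝ} (h0 : 0 ≤ q) (h1 : q < 1) :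
    HasSum (negBinomialMass m q) 1 := by
  obtain ⟨l, rfl⟩ := Nat.exists_eq_add_of_le' hm
  have hq : ‖q‖ < 1 := by rwa [Real.norm_of_nonneg h0]
  have h := (hasSum_choose_mul_geometric_of_norm_lt_one l hq).mul_right ((1 - q) ^ (l + 1))
  rw [one_div_mul_cancel (pow_ne_zero _ (sub_pos.2 h1).ne')] at h
  refine h.congr_fun fun k => ?_
  rw [negBinomialMass, ← Nat.choose_symm_add]
  rfl

theorem tendsto_sum_negBinomialMass {m : ℕ} (hm : 1 ≤ m) (d c : ℕ) :
    Tendsto (fun x : ℝ => ∑ k ∈ Finset.range c, negBinomialMass m (x ^ d) k)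
      (nhds 1) (nhds 0) := by
  have hcont : Continuous fun x : ℝ => ∑ k ∈ Finset.range c, negBinomialMass m (x ^ d) k := by
    unfold negBinomialMass
    fun_prop
  have hzero : ∑ k ∈ Finset.range c, negBinomialMass m ((1 : ℝ) ^ d) k = 0 :=
    Finset.sum_eq_zero fun k _ => by
      simp [negBinomialMass, Nat.one_le_iff_ne_zero.1 hm]
  simpa only [hzero] using hcont.tendsto 1

/-- Union bound: if every `z ∈ S` has some coordinate `z j < C j`, the product mass of `S` is at
most the sum of the marginal masses of `{k | k < C j}`. -/
theorem tsum_subtype_prod_le_sum {n : ℕ} {f : Fin n → ℕ → ℝ} (hf : ∀ i k, 0 ≤ f i k)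
    (hsum : ∀ i, HasSum (f i) 1) (C : Fin n → ℕ) {S : Set (Fin n → ℕ)}
    (hS : ∀ z ∈ S, ∃ j, z j < C j) :
    ∑' z : S, ∏ i, f i (z.1 i) ≤ ∑ j, ∑ k ∈ Finset.range (C j), f j k := by
  classical
  let g (j i : Fin n) : ℕ → ℝ :=
    if i = j then (Finset.range (C j) : Set ℕ).indicator (f j) else f i
  have hg (j i : Fin n) (k : ℕ) : 0 ≤ g j i k := by
    by_cases hij : i = j
    · simpa [g, hij] using Set.indicator_nonneg (fun k _ => hf j k) k
    · simpa [g, hij] using hf i k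
  have hgsum (j : Fin n) : HasSum (fun z : Fin n → ℕ => ∏ i, g j i (z i))
      (∑ k ∈ Finset.range (C j), f j k) := by
    have h := hasSum_prod_fin_of_nonneg (hg j)
      (a := fun i => if i = j then ∑ k ∈ Finset.range (C j), f j k else 1) fun i => by
        by_cases hij : i = j
        · simp only [g, hij, if_true]
          rw [← hasSum_subtype_iff_indicator]
          exact Finset.hasSum _ _
        · simpa [g, hij] using hsum i
    simpa using h
  have htotal := (hasSum_prod_fin_of_nonneg hf hsum).summable
  rw [tsum_subtype S fun z => ∏ i, f i (z i)]
  refine hasSum_le (fun z => ?_) (htotal.indicator S).hasSum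
    (hasSum_sum fun j (_ : j ∈ Finset.univ) => hgsum j)
  have hprod (j : Fin n) : 0 ≤ ∏ i, g j i (z i) := Finset.prod_nonneg fun i _ => hg j i (z i)
  by_cases hz : z ∈ S
  · obtain ⟨j, hj⟩ := hS z hz
    rw [Set.indicator_of_mem hz]
    calc ∏ i, f i (z i) = ∏ i, g j i (z i) := Finset.prod_congr rfl fun i _ => by
          by_cases hij : i = j
          · subst hij
            simp [g, hj]
          · simp [g, hij]
      _ ≤ _ := Finset.single_le_sum (fun j _ => hprod j) (Finset.mem_univ j)
  · rw [Set.indicator_of_notMem hz]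
    exact Finset.sum_nonneg fun j _ => hprod j

/-- Verification of condition (6) of the paper for multisets: with `Zᵢ` independent
negative binomial `NB(mᵢ, xⁱ)`, the pivot mass of a column label `C` (the product mass of
the set of pivot rows) tends to `0` as `x → 1⁻` within `(0,1)`. -/
theorem multiset_pivot_mass_tendsto_zero
    (n : ℕ) (hn : 1 ≤ n) (m : Fin n → ℕ) (hm : ∀ i, 1 ≤ m i)
    (C : Fin n → ℕ) (hC : ∑ i : Fin n, ((i : ℕ) + 1) * C i = n) :
    Tendsto
      (fun x : ℝ =>
        ∑' z : {z : Fin n → ℕ // 1 < ∑ i : Fin n, (C i - z i)},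
          ∏ i : Fin n,
            ((z.1 i + m i - 1).choose (z.1 i) : ℝ) * x ^ (((i : ℕ) + 1) * z.1 i) *
              (1 - x ^ ((i : ℕ) + 1)) ^ (m i))
      (nhdsWithin 1 (Set.Ioo (0 : ℝ) 1)) (nhds 0) := by
  have hlim : Tendsto (fun x : ℝ => ∑ j : Fin n, ∑ k ∈ Finset.range (C j),
      negBinomialMass (m j) (x ^ ((j : ℕ) + 1)) k)
      (nhdsWithin 1 (Set.Ioo (0 : ℝ) 1)) (nhds 0) := by
    simpa using tendsto_finsetSum (Finset.univ : Finset (Fin n)) fun j _ =>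
      (tendsto_sum_negBinomialMass (hm j) ((j : ℕ) + 1) (C j)).mono_left nhdsWithin_le_nhds
  have hpivot : ∀ z ∈ {z : Fin n → ℕ | 1 < ∑ i : Fin n, (C i - z i)}, ∃ j, z j < C j := by
    intro z hz
    by_contra! h
    have hzero : ∑ i : Fin n, (C i - z i) = 0 :=
      Finset.sum_eq_zero fun i _ => Nat.sub_eq_zero_of_le (h i)
    simp [hzero] at hz
  simp only [pow_mul]
  refine tendsto_of_tendsto_of_tendsto_of_le_of_le' tendsto_const_nhds hlim ?_ ?_
  · filter_upwards [self_mem_nhdsWithin] with x hx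
    exact tsum_nonneg fun z => Finset.prod_nonneg fun i _ =>
      negBinomialMass_nonneg (pow_nonneg hx.1.le _) (pow_le_one₀ hx.1.le hx.2.le) _
  · filter_upwards [self_mem_nhdsWithin] with x hx
    exact tsum_subtype_prod_le_sum
      (fun i => negBinomialMass_nonneg (pow_nonneg hx.1.le _) (pow_le_one₀ hx.1.le hx.2.le))
      (fun i => hasSum_negBinomialMass (hm i) (pow_nonneg hx.1.le _)
        (pow_lt_one₀ hx.1.le hx.2 (Nat.succ_ne_zero _))) C hpivot
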